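/- arXiv:2305.16327 — 2 statements merged into one kernel-verified Lean document; each statement's English description precedes it below -/
import Mathlib

section
/- For all X, Y ∈ 𝔤 one has ∇̃_{X^v}Y^c = (∇²_X Y + ½(ad₂ X)*Y)^v. -/
/-- `g` is an inner product (symmetric positive-definite bilinear form) on a real vector space. -/
structure IsInnerProd {L : Type*} [AddCommGroup L] [Module ℝ L] (g : L → L → ℝ) : Prop where
  addLeft : ∀ x y z : L, g (x + y) z = g x z + g y z
  smulLeft : ∀ (a : ℝ) (x y : L), g (a • x) y = a * g x y
  symm : ∀ x y : L, g x y = g y x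
  posDef : ∀ x : L, x ≠ 0 → 0 < g x x

/-- The bracket of the tangent Lie algebra `T𝔤 = 𝔤 × 𝔤`:
`[(X₁,Y₁),(X₂,Y₂)] = ([X₁,X₂], [X₁,Y₂] + [Y₁,X₂])`.
The complete lift of `X` is `(X, 0)` and the vertical lift is `(0, X)`. -/
def tbr {L : Type*} [LieRing L] (A B : L × L) : L × L :=
  (⁅A.1, B.1⁆, ⁅A.1, B.2⁆ + ⁅A.2, B.1⁆)

/-- The lifted inner product `g̃` on `T𝔤 = 𝔤 × 𝔤` determined by
`g̃(X^c,Y^c) = ⟨X,Y⟩₁`, `g̃(X^v,Y^v) = ⟨X,Y⟩₂`, `g̃(X^c,Y^v) = 0`. -/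
def tg {L : Type*} (g1 g2 : L → L → ℝ) (A B : L × L) : ℝ :=
  g1 A.1 B.1 + g2 A.2 B.2

/-- `nab` is the Levi-Civita connection of the metric `g` with respect to the bracket `br`,
i.e. it satisfies the Koszul formula
`2⟨∇_X Y, Z⟩ = ⟨[X,Y],Z⟩ − ⟨[Y,Z],X⟩ + ⟨[Z,X],Y⟩`. -/
def IsLC {V : Type*} [AddCommGroup V] [Module ℝ V] (br : V → V → V)
    (g : V → V → ℝ) (nab : V → V → V) : Prop :=
  ∀ X Y Z : V, 2 * g (nab X Y) Z = g (br X Y) Z - g (br Y Z) X + g (br Z X) Y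

/-- The curvature tensor `R(X,Y)Z = ∇_X ∇_Y Z − ∇_Y ∇_X Z − ∇_{[X,Y]} Z`. -/
def curvOf {V : Type*} [AddCommGroup V] (br nab : V → V → V) (X Y Z : V) : V :=
  nab X (nab Y Z) - nab Y (nab X Z) - nab (br X Y) Z

namespace IsInnerProd

variable {L : Type*} [AddCommGroup L] [Module ℝ L] {g : L → L → ℝ}

theorem neg_left (hg : IsInnerProd g) (x z : L) : g (-x) z = -g x z := by
  simpa using hg.smulLeft (-1) x z

theorem zero_left (hg : IsInnerProd g) (z : L) : g 0 z = 0 := by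
  simpa using hg.smulLeft 0 0 z

theorem zero_right (hg : IsInnerProd g) (z : L) : g z 0 = 0 := by
  rw [hg.symm, hg.zero_left]

theorem ext_left (hg : IsInnerProd g) {x y : L} (h : ∀ z, g x z = g y z) : x = y := by
  by_contra hne
  have hpos := hg.posDef (x + -y) fun h0 => hne (by rwa [← sub_eq_add_neg, sub_eq_zero] at h0)
  rw [hg.addLeft, hg.neg_left, h] at hpos
  linarith

end IsInnerProd

theorem statement4 {L : Type*} [LieRing L] [Module ℝ L] [LieAlgebra ℝ L]
    [FiniteDimensional ℝ L]
    (g1 g2 : L → L → ℝ) (hg1 : IsInnerProd g1) (hg2 : IsInnerProd g2)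
    (nabla1 nabla2 : L → L → L)
    (hn1 : IsLC (fun X Y : L => ⁅X, Y⁆) g1 nabla1)
    (hn2 : IsLC (fun X Y : L => ⁅X, Y⁆) g2 nabla2)
    (tnabla : L × L → L × L → L × L)
    (htn : IsLC tbr (tg g1 g2) tnabla)
    (ads : L → L → L)
    (hads : ∀ X Y Z : L, g2 (ads X Y) Z = g2 Y ⁅X, Z⁆) :
    ∀ X Y : L, tnabla (0, X) (Y, 0) = ((0 : L), nabla2 X Y + ((1 : ℝ) / 2) • ads X Y) := by
  intro X Y
  ext1
  · refine hg1.ext_left fun Z => ?_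
    have h := htn (0, X) (Y, 0) (Z, 0)
    simp only [tg, tbr, zero_lie, lie_zero, add_zero, zero_add, hg1.zero_left, hg1.zero_right,
      hg2.zero_left, hg2.zero_right] at h
    rw [hg1.zero_left]
    linarith
  · refine hg2.ext_left fun Z => ?_
    have h := htn (0, X) (Y, 0) (0, Z)
    simp only [tg, tbr, zero_lie, lie_zero, add_zero, zero_add, hg1.zero_left, hg1.zero_right,
      hg2.zero_left] at h
    have hnabla := hn2 X Y Z
    have hswap : g2 ⁅Z, X⁆ Y = -g2 Y ⁅X, Z⁆ := by
      rw [← lie_skew, hg2.neg_left, hg2.symm]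
    rw [hg2.addLeft, hg2.smulLeft, hads]
    simp only at hnabla
    linarith
end

section
/- Let X ∈ 𝔤. Then X^v is a Killing vector field with respect to g̃ on T𝔤 (i.e. g̃([X^v,Ã],B̃) + g̃(Ã,[X^v,B̃]) = 0 for all Ã,B̃ ∈ T𝔤) if and only if X belongs to the center Z(𝔤) = {Y ∈ 𝔤 : [X,Y] = 0 for all X ∈ 𝔤}. -/
theorem IsInnerProd.zero_left_s10 {L : Type*} [AddCommGroup L] [Module ℝ L] {g : L → L → ℝ}
    (hg : IsInnerProd g) (z : L) : g 0 z = 0 := by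
  simpa using hg.addLeft 0 0 z

theorem IsInnerProd.zero_right_s10 {L : Type*} [AddCommGroup L] [Module ℝ L] {g : L → L → ℝ}
    (hg : IsInnerProd g) (z : L) : g z 0 = 0 := by
  rw [hg.symm, hg.zero_left_s10]

theorem tbr_vertical {L : Type*} [LieRing L] (X : L) (A : L × L) :
    tbr (0, X) A = (0, ⁅X, A.1⁆) := by
  simp [tbr]

theorem statement10 {L : Type*} [LieRing L] [Module ℝ L] [LieAlgebra ℝ L]
    [FiniteDimensional ℝ L]
    (g1 g2 : L → L → ℝ) (hg1 : IsInnerProd g1) (hg2 : IsInnerProd g2)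
    (X : L) :
    (∀ A B : L × L, tg g1 g2 (tbr (0, X) A) B + tg g1 g2 A (tbr (0, X) B) = 0) ↔
    (∀ Y : L, ⁅Y, X⁆ = 0) := by
  simp only [tbr_vertical, tg, hg1.zero_left_s10, hg1.zero_right_s10, zero_add]
  constructor
  · intro h Y
    have hXY : ⁅X, Y⁆ = 0 := by
      by_contra hne
      have hself : g2 ⁅X, Y⁆ ⁅X, Y⁆ = 0 := by
        simpa [hg2.zero_right_s10] using h (Y, 0) (0, ⁅X, Y⁆)
      exact (hg2.posDef _ hne).ne' hself
    rw [← lie_skew, hXY, neg_zero]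
  · intro h A B
    have hX (Y : L) : ⁅X, Y⁆ = 0 := by rw [← lie_skew, h, neg_zero]
    rw [hX, hX, hg2.zero_left_s10, hg2.zero_right_s10, add_zero]
end
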